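/- Let n ≥ 3 and let (c_1,…,c_n) ∈ 𝒜⁺. For 1 ≤ i ≤ n define the 2×2 integer matrix M_i = τ·η(c_i) if i is odd and M_i = η(c_i)·τ if i is even, and for 0 ≤ ν ≤ n−1 set β_ν = M_1·M_2⋯M_ν·e, where e is the column vector (0,1) if ν is even and (1,0) if ν is odd (so β_0 = (0,1)). Then β_0,…,β_{n−1} are n pairwise distinct vectors in ℕ², and listing them in ascending order with respect to ≤_ℚ yields an ℰ-sequence. Conversely, for every ℰ-sequence f of length n there exists (c_1,…,c_n) ∈ 𝒜⁺ such that the set of entries of f equals {β_0,…,β_{n−1}}. -/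

import Mathlib

/-- The matrix `η(x) = [[x, -1], [1, 0]]`. -/
def eta (x : ℤ) : Matrix (Fin 2) (Fin 2) ℤ :=
  !![x, -1; 1, 0]

/-- The matrix `τ = [[0, 1], [1, 0]]`. -/
def tau : Matrix (Fin 2) (Fin 2) ℤ :=
  !![0, 1; 1, 0]

/-- The partial product `η(c_1)·η(c_2)⋯η(c_k)` (here `c i` is the `i`-th Cartan
entry, `1`-indexed). -/
def etaProd (c : ℕ → ℤ) (k : ℕ) : Matrix (Fin 2) (Fin 2) ℤ :=
  ((List.range k).map (fun j => eta (c (j + 1)))).prod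

/-- `(c_1, …, c_n)` belongs to `𝒜⁺`: `n ≥ 1`, all entries are `≥ 1`,
`η(c_1)⋯η(c_n) = -Id`, and for every `i < n` both entries of the first column of
`η(c_1)⋯η(c_i)` are nonnegative. -/
def APlus (n : ℕ) (c : ℕ → ℤ) : Prop :=
  1 ≤ n ∧ (∀ i, 1 ≤ i → i ≤ n → 1 ≤ c i) ∧ etaProd c n = -1 ∧
    ∀ i < n, 0 ≤ etaProd c i 0 0 ∧ 0 ≤ etaProd c i 1 0

/-- `M_i = τ·η(c_i)` if `i` is odd and `M_i = η(c_i)·τ` if `i` is even. -/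
def Mmat (c : ℕ → ℤ) (i : ℕ) : Matrix (Fin 2) (Fin 2) ℤ :=
  if Odd i then tau * eta (c i) else eta (c i) * tau

/-- `β_ν = M_1·M_2⋯M_ν·e` with `e = (0,1)` for even `ν` and `e = (1,0)` for odd `ν`. -/
def beta (c : ℕ → ℤ) (ν : ℕ) : Fin 2 → ℤ :=
  (((List.range ν).map (fun j => Mmat c (j + 1))).prod).mulVec
    (if ν % 2 = 0 then ![0, 1] else ![1, 0])

/-- ℰ-sequences: generated from `((0,1),(1,1),(1,0))` by inserting the sum of two
consecutive entries between them. -/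
inductive IsESeq : List (ℕ × ℕ) → Prop
  | base : IsESeq [(0, 1), (1, 1), (1, 0)]
  | step (l₁ l₂ : List (ℕ × ℕ)) (v w : ℕ × ℕ) :
      IsESeq (l₁ ++ v :: w :: l₂) → IsESeq (l₁ ++ v :: (v + w) :: w :: l₂)

/-- Consecutive vectors `p`, `q` with `det (q, p) = 1`. -/
def FareyAdj (p q : ℕ × ℕ) : Prop :=
  q.1 * p.2 = p.1 * q.2 + 1

/-- The strict version of the order by slope. -/
def SlopeLT (p q : ℕ × ℕ) : Prop :=
  p.1 * q.2 < q.1 * p.2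

theorem SlopeLT.trans {p q r : ℕ × ℕ} (h₁ : SlopeLT p q) (h₂ : SlopeLT q r) :
    SlopeLT p r := by
  unfold SlopeLT at *
  have hq : 0 < q.2 := Nat.pos_of_ne_zero fun h => by simp [h] at h₂
  have hp : 0 < p.2 := Nat.pos_of_ne_zero fun h => by simp [h] at h₁
  have h₃ : p.1 * q.2 * r.2 ≤ q.1 * p.2 * r.2 := Nat.mul_le_mul_right _ h₁.le
  have h₄ : q.1 * r.2 * p.2 < r.1 * q.2 * p.2 := Nat.mul_lt_mul_of_pos_right h₂ hp
  refine lt_of_mul_lt_mul_right (a := q.2) ?_ hq.le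
  linarith

instance : IsTrans (ℕ × ℕ) SlopeLT := ⟨fun _ _ _ => SlopeLT.trans⟩

theorem FareyAdj.slopeLT {p q : ℕ × ℕ} (h : FareyAdj p q) : SlopeLT p q := by
  unfold FareyAdj at h
  unfold SlopeLT
  omega

theorem pairwise_slopeLT {l : List (ℕ × ℕ)} (h : l.IsChain FareyAdj) :
    l.Pairwise SlopeLT :=
  (h.imp fun _ _ => FareyAdj.slopeLT).pairwise

/-- A chain of Farey neighbours from `(0, 1)` to `(1, 0)`. -/
structure IsFareyPath (l : List (ℕ × ℕ)) : Prop where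
  isChain : l.IsChain FareyAdj
  head : l.head? = some (0, 1)
  last : l.getLast? = some (1, 0)

theorem isChain_insert_iff {l₁ l₂ : List (ℕ × ℕ)} {v w : ℕ × ℕ} :
    (l₁ ++ v :: (v + w) :: w :: l₂).IsChain FareyAdj ↔
      (l₁ ++ v :: w :: l₂).IsChain FareyAdj := by
  have h₁ : FareyAdj v (v + w) ↔ FareyAdj v w := by
    simp only [FareyAdj, Prod.fst_add, Prod.snd_add, add_mul, mul_add]
    omega
  have h₂ : FareyAdj (v + w) w ↔ FareyAdj v w := by
    simp only [FareyAdj, Prod.fst_add, Prod.snd_add, add_mul, mul_add]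
    omega
  rw [List.isChain_split, List.isChain_split (l₁ := l₁) (l₂ := w :: l₂)]
  simp only [List.isChain_cons_cons, h₁, h₂]
  tauto

theorem isFareyPath_insert_iff {l₁ l₂ : List (ℕ × ℕ)} {v w : ℕ × ℕ} :
    IsFareyPath (l₁ ++ v :: (v + w) :: w :: l₂) ↔ IsFareyPath (l₁ ++ v :: w :: l₂) := by
  have hh : (l₁ ++ v :: (v + w) :: w :: l₂).head? = (l₁ ++ v :: w :: l₂).head? := by
    cases l₁ <;> simp
  have hl : (l₁ ++ v :: (v + w) :: w :: l₂).getLast? = (l₁ ++ v :: w :: l₂).getLast? := by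
    simp [List.getLast?_append, List.getLast?_cons_cons]
  exact ⟨fun h => ⟨isChain_insert_iff.1 h.1, hh ▸ h.2, hl ▸ h.3⟩,
    fun h => ⟨isChain_insert_iff.2 h.1, hh ▸ h.2, hl ▸ h.3⟩⟩

theorem IsESeq.isFareyPath {l : List (ℕ × ℕ)} (h : IsESeq l) : IsFareyPath l := by
  induction h with
  | base => exact ⟨by simp [FareyAdj], rfl, rfl⟩
  | step l₁ l₂ v w _ ih => exact isFareyPath_insert_iff.2 ih

theorem FareyAdj.eq_add {p q r : ℕ × ℕ} (h₁ : FareyAdj p q) (h₂ : FareyAdj q r)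
    (hp : p.1 + p.2 < q.1 + q.2) (hr : r.1 + r.2 ≤ q.1 + q.2) : q = p + r := by
  obtain ⟨a, b⟩ := p
  obtain ⟨c, d⟩ := q
  obtain ⟨e, f⟩ := r
  simp only [FareyAdj, Prod.mk_add_mk, Prod.mk.injEq] at *
  zify at *
  obtain ⟨k, hk⟩ : ∃ k : ℤ, k = e * b - a * f := ⟨_, rfl⟩
  have hc : k * c = a + e := by rw [hk]; linear_combination (e : ℤ) * h₁ + (a : ℤ) * h₂
  have hd : k * d = b + f := by rw [hk]; linear_combination (f : ℤ) * h₁ + (b : ℤ) * h₂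
  have hs : k * (c + d) = a + b + (e + f) := by linear_combination hc + hd
  have hlt : k < 2 := by
    by_contra! hk2
    nlinarith
  have hpos : 0 < k := by
    by_contra! hk0
    have h0 : k * (c + d : ℤ) ≤ 0 := mul_nonpos_of_nonpos_of_nonneg hk0 (by positivity)
    have ha : (a : ℤ) = 0 := by omega
    have hb : (b : ℤ) = 0 := by omega
    simp [ha, hb] at h₁
  obtain rfl : k = 1 := by omega
  constructor <;> linarith

/-- A chain of Farey neighbours which starts with an increase of the coordinate sum and ends
in `(1, 0)` contains the sum of its two neighbours. -/
theorem exists_mediant (t : List (ℕ × ℕ)) (p q : ℕ × ℕ)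
    (hc : (p :: q :: t).IsChain FareyAdj) (hlt : p.1 + p.2 < q.1 + q.2)
    (hl : (p :: q :: t).getLast? = some (1, 0)) :
    ∃ l₁ l₂ v w, p :: q :: t = l₁ ++ v :: (v + w) :: w :: l₂ := by
  induction t generalizing p q with
  | nil =>
    simp only [List.getLast?_cons_cons, List.getLast?_singleton, Option.some.injEq] at hl
    subst hl
    simp only [List.isChain_pair, FareyAdj] at hc
    simp at hlt
    omega
  | cons r t ih =>
    rw [List.isChain_cons_cons] at hc
    rw [List.getLast?_cons_cons] at hl
    by_cases hr : r.1 + r.2 ≤ q.1 + q.2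
    · exact ⟨[], t, p, r, by
        rw [hc.1.eq_add (List.isChain_cons_cons.1 hc.2).1 hlt hr]; rfl⟩
    · obtain ⟨l₁, l₂, v, w, h⟩ := ih q r hc.2 (not_le.1 hr) hl
      exact ⟨p :: l₁, l₂, v, w, by rw [h]; rfl⟩

theorem IsFareyPath.isESeq {l : List (ℕ × ℕ)} (h : IsFareyPath l) (hlen : 3 ≤ l.length) :
    IsESeq l := by
  induction hm : l.length using Nat.strong_induction_on generalizing l with
  | _ m ih =>
  match l, hlen with
  | p :: q :: r :: t, _ =>
    obtain ⟨hc, hp, hl⟩ := h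
    simp only [List.head?_cons, Option.some.injEq] at hp
    subst hp
    obtain ⟨q₁, q₂⟩ := q
    have hpq := (List.isChain_cons_cons.1 hc).1
    have hqr := (List.isChain_cons_cons.1 (List.isChain_cons_cons.1 hc).2).1
    have hq₁ : q₁ = 1 := by simpa [FareyAdj] using hpq
    have hq₂ : 0 < q₂ := Nat.pos_of_ne_zero fun h => by simp [FareyAdj, h] at hqr
    obtain ⟨l₁, l₂, v, w, heq⟩ :=
      exists_mediant (r :: t) (0, 1) (q₁, q₂) hc (by simp; omega) hl
    rcases t with _ | ⟨s, t⟩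
    · simp only [List.getLast?_cons_cons, List.getLast?_singleton, Option.some.injEq] at hl
      subst hl
      simp only [FareyAdj] at hqr
      obtain rfl : q₂ = 1 := by omega
      subst hq₁
      exact IsESeq.base
    · rw [heq] at hm ⊢
      have hlen' := congrArg List.length heq
      simp only [List.length_cons, List.length_append] at hlen' hm
      refine IsESeq.step _ _ _ _ (ih _ ?_ (isFareyPath_insert_iff.1 ?_) ?_ rfl)
      · simp only [List.length_cons, List.length_append]
        omega
      · rw [← heq]
        exact ⟨hc, rfl, hl⟩
      · simp only [List.length_cons, List.length_append]
        omega

theorem etaProd_succ (c : ℕ → ℤ) (k : ℕ) :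
    etaProd c (k + 1) = etaProd c k * eta (c (k + 1)) := by
  simp [etaProd, List.range_succ]

theorem etaProd_succ_apply_one (c : ℕ → ℤ) (k : ℕ) (i : Fin 2) :
    etaProd c (k + 1) i 1 = -etaProd c k i 0 := by
  simp [etaProd_succ, Matrix.mul_apply, Fin.sum_univ_two, eta]

theorem tau_mul_tau : tau * tau = 1 := by
  simp [tau, Matrix.one_fin_two]

theorem prod_Mmat (c : ℕ → ℤ) (k : ℕ) :
    ((List.range k).map (fun j => Mmat c (j + 1))).prod =
      tau * etaProd c k * (if k % 2 = 0 then tau else 1) := by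
  induction k with
  | zero => simp [etaProd, tau_mul_tau]
  | succ k ih =>
    rw [List.range_succ, List.map_append, List.prod_append, ih, etaProd_succ]
    rcases Nat.even_or_odd k with hk | hk
    · have h₁ : k % 2 = 0 := Nat.even_iff.1 hk
      have h₂ : (k + 1) % 2 ≠ 0 := by omega
      simp only [h₁, h₂, Mmat, hk.add_one, if_true, if_false, List.map_cons, List.map_nil,
        List.prod_singleton, mul_one]
      rw [mul_assoc, ← mul_assoc tau tau, tau_mul_tau, one_mul, mul_assoc]
    · have h₁ : k % 2 ≠ 0 := by have := Nat.odd_iff.1 hk; omega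
      have h₂ : (k + 1) % 2 = 0 := by omega
      have h₃ : ¬ Odd (k + 1) := by simpa using hk.add_one
      simp only [h₁, h₂, h₃, Mmat, if_true, if_false, List.map_cons, List.map_nil,
        List.prod_singleton, mul_one, mul_assoc]

theorem beta_eq (c : ℕ → ℤ) (k : ℕ) :
    beta c k = ![etaProd c k 1 0, etaProd c k 0 0] := by
  rw [beta, prod_Mmat]
  ext i
  by_cases hk : k % 2 = 0 <;> fin_cases i <;>
    simp [hk, tau, Matrix.mulVec, Matrix.vecMul, dotProduct, Matrix.mul_apply, Fin.sum_univ_two]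

theorem det_etaProd (c : ℕ → ℤ) (k : ℕ) : (etaProd c k).det = 1 := by
  induction k with
  | zero => simp [etaProd]
  | succ k ih => rw [etaProd_succ, Matrix.det_mul, ih]; simp [eta, Matrix.det_fin_two]

theorem etaProd_consecutive (c : ℕ → ℤ) (k : ℕ) :
    etaProd c (k + 1) 1 0 * etaProd c k 0 0 = etaProd c k 1 0 * etaProd c (k + 1) 0 0 + 1 := by
  have h := det_etaProd c (k + 1)
  rw [Matrix.det_fin_two, etaProd_succ_apply_one, etaProd_succ_apply_one] at h
  linarith

/-- The vectors `beta c ν` as pairs of natural numbers. -/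
def betaPair (c : ℕ → ℤ) (ν : ℕ) : ℕ × ℕ :=
  ((etaProd c ν 1 0).toNat, (etaProd c ν 0 0).toNat)

theorem APlus.betaPair_eq {n : ℕ} {c : ℕ → ℤ} (h : APlus n c) {ν : ℕ} (hν : ν < n) :
    (![((betaPair c ν).1 : ℤ), ((betaPair c ν).2 : ℤ)] : Fin 2 → ℤ) = beta c ν := by
  obtain ⟨h₀, h₁⟩ := h.2.2.2 ν hν
  rw [beta_eq, betaPair, Int.toNat_of_nonneg h₀, Int.toNat_of_nonneg h₁]

theorem APlus.isFareyPath {n : ℕ} {c : ℕ → ℤ} (h : APlus n c) :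
    IsFareyPath ((List.range n).map (betaPair c)) := by
  obtain ⟨m, rfl⟩ : ∃ m, n = m + 1 := ⟨n - 1, by have := h.1; omega⟩
  refine ⟨?_, ?_, ?_⟩
  · rw [List.isChain_iff_getElem]
    intro i hi
    simp only [List.length_map, List.length_range] at hi
    simp only [List.getElem_map, List.getElem_range, FareyAdj, betaPair]
    have h₁ := h.2.2.2 i (by omega)
    have h₂ := h.2.2.2 (i + 1) hi
    zify
    rw [Int.toNat_of_nonneg h₁.1, Int.toNat_of_nonneg h₁.2, Int.toNat_of_nonneg h₂.1,
      Int.toNat_of_nonneg h₂.2]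
    exact etaProd_consecutive c i
  · simp [List.range_succ_eq_map, betaPair, etaProd]
  · have h₀ := congrFun (congrFun h.2.2.1 0) 1
    have h₁ := congrFun (congrFun h.2.2.1 1) 1
    rw [etaProd_succ_apply_one] at h₀ h₁
    simp at h₀ h₁
    simp [List.range_succ, betaPair, h₀, h₁]

/-- The entries of `etaProd` are recovered from any sequence of plane vectors whose consecutive
determinants are `1`. -/
theorem etaProd_eq_of_unimodular {n : ℕ} {c X Y : ℕ → ℤ}
    (hX₀ : X 0 = -1) (hY₀ : Y 0 = 0) (hX₁ : X 1 = 0) (hY₁ : Y 1 = 1)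
    (hdet : ∀ k ≤ n, X (k + 1) * Y k = X k * Y (k + 1) + 1)
    (hc : ∀ k < n, c (k + 1) = X (k + 2) * Y k - X k * Y (k + 2)) :
    ∀ k ≤ n, etaProd c k = !![Y (k + 1), -Y k; X (k + 1), -X k] := by
  intro k
  induction k with
  | zero => simp [hX₀, hY₀, hX₁, hY₁, etaProd, Matrix.one_fin_two]
  | succ k ih =>
    intro hk
    have h₁ := hdet k (by omega)
    have h₂ := hdet (k + 1) hk
    rw [etaProd_succ, ih (by omega), hc k (by omega)]
    ext i j
    fin_cases i <;> fin_cases j <;>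
      simp [eta, Matrix.mul_apply, Fin.sum_univ_two]
    · linear_combination Y (k + 2) * h₁ + Y k * h₂
    · linear_combination X (k + 2) * h₁ + X k * h₂

theorem IsFareyPath.exists_aPlus {l : List (ℕ × ℕ)} (h : IsFareyPath l) (hl : 3 ≤ l.length) :
    ∃ c : ℕ → ℤ, APlus l.length c ∧ ∀ k (hk : k < l.length),
      beta c k = ![(l[k].1 : ℤ), (l[k].2 : ℤ)] := by
  set X : ℕ → ℤ := fun k => k.casesOn (-1) fun i => if h : i < l.length then (l[i].1 : ℤ) else 0
    with hX
  set Y : ℕ → ℤ := fun k => k.casesOn 0 fun i => if h : i < l.length then (l[i].2 : ℤ) else -1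
    with hY
  have hXs : ∀ k (hk : k < l.length), X (k + 1) = l[k].1 := fun k hk => by simp [hX, hk]
  have hYs : ∀ k (hk : k < l.length), Y (k + 1) = l[k].2 := fun k hk => by simp [hY, hk]
  have hXn : X (l.length + 1) = 0 := by simp [hX]
  have hYn : Y (l.length + 1) = -1 := by simp [hY]
  have hhead : l[0] = (0, 1) := by
    have := h.head
    rw [List.head?_eq_getElem?, List.getElem?_eq_getElem (by omega)] at this
    simpa using this
  have hlast : l[l.length - 1] = (1, 0) := by
    have := h.last
    rw [List.getLast?_eq_getElem?, List.getElem?_eq_getElem (by omega)] at this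
    simpa using this
  have hX₁ : X 1 = 0 := by simp [hXs 0 (by omega), hhead]
  have hY₁ : Y 1 = 1 := by simp [hYs 0 (by omega), hhead]
  have hXl : X l.length = 1 := by
    have := hXs (l.length - 1) (by omega)
    rwa [hlast, Nat.sub_add_cancel (by omega), Nat.cast_one] at this
  have hYl : Y l.length = 0 := by
    have := hYs (l.length - 1) (by omega)
    rwa [hlast, Nat.sub_add_cancel (by omega), Nat.cast_zero] at this
  have hchain := List.isChain_iff_getElem.1 h.isChain
  have hpair := List.pairwise_iff_getElem.1 (pairwise_slopeLT h.isChain)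
  have hdet : ∀ k ≤ l.length, X (k + 1) * Y k = X k * Y (k + 1) + 1 := by
    intro k hk
    rcases k with _ | k
    · simp [hX₁, hY₁, show X 0 = -1 from rfl, show Y 0 = 0 from rfl]
    · rcases hk.eq_or_lt with hk | hk
      · rw [hk, hXn, hYn, hXl, hYl]
        norm_num
      · rw [hXs _ hk, hYs _ hk, hXs k (by omega), hYs k (by omega)]
        exact_mod_cast hchain k hk
  obtain ⟨c, hc⟩ : ∃ c : ℕ → ℤ, ∀ k, c (k + 1) = X (k + 2) * Y k - X k * Y (k + 2) :=
    ⟨fun k => X (k + 1) * Y (k - 1) - X (k - 1) * Y (k + 1), fun _ => rfl⟩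
  have hprod := etaProd_eq_of_unimodular (n := l.length) (c := c) (X := X) (Y := Y)
    rfl rfl hX₁ hY₁ hdet (fun k _ => hc k)
  refine ⟨c, ⟨by omega, ?_, ?_, ?_⟩, ?_⟩
  · intro i hi hin
    obtain ⟨i, rfl⟩ := Nat.exists_eq_add_of_le' hi
    rw [hc]
    rcases i with _ | i
    · have h₁₂ := hpair 1 2 (by omega) (by omega) (by omega)
      have hpos : 0 < l[1].2 := Nat.pos_of_ne_zero fun h => by simp [SlopeLT, h] at h₁₂
      have h₂ : Y (0 + 2) = l[1].2 := hYs 1 (by omega)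
      rw [h₂, show X 0 = -1 from rfl, show Y 0 = 0 from rfl]
      omega
    · rcases hin.eq_or_lt with hin | hin
      · have h₁₂ := hpair 0 i (by omega) (by omega) (by omega)
        have hpos : 0 < l[i].1 := Nat.pos_of_ne_zero fun h => by simp [SlopeLT, h] at h₁₂
        rw [show i + 1 + 2 = l.length + 1 by omega, hXn, hYn, hXs i (by omega)]
        omega
      · have h₁₂ := hpair i (i + 2) (by omega) (by omega) (by omega)
        rw [hXs (i + 2) hin, hYs (i + 2) hin, hXs i (by omega), hYs i (by omega)]
        unfold SlopeLT at h₁₂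
        zify at h₁₂
        linarith
  · rw [hprod _ le_rfl, hXn, hYn, hXl, hYl]
    ext i j
    fin_cases i <;> fin_cases j <;> simp
  · intro i hi
    rw [hprod i hi.le]
    simp [hXs i hi, hYs i hi]
  · intro k hk
    rw [beta_eq, hprod k hk.le]
    simp [hXs k hk, hYs k hk]

/-- For `(c_1,…,c_n) ∈ 𝒜⁺` the vectors `β_0, …, β_{n-1}` are `n` pairwise distinct
vectors in `ℕ²`, and listing them in ascending order with respect to `≤_ℚ` yields an
ℰ-sequence. Conversely, every ℰ-sequence `f` of length `n` arises this way: there is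
`(c_1,…,c_n) ∈ 𝒜⁺` such that the set of entries of `f` equals `{β_0, …, β_{n-1}}`. -/
theorem stmt_3 (n : ℕ) (hn : 3 ≤ n) :
    (∀ c : ℕ → ℤ, APlus n c →
      (∀ ν < n, 0 ≤ beta c ν 0 ∧ 0 ≤ beta c ν 1) ∧
      (∀ μ ν : ℕ, μ < ν → ν < n → beta c μ ≠ beta c ν) ∧
      (∃ f : List (ℕ × ℕ), IsESeq f ∧
        f.Pairwise (fun p q => p.1 * q.2 ≤ q.1 * p.2) ∧
        (f.map (fun p => (![(p.1 : ℤ), (p.2 : ℤ)] : Fin 2 → ℤ))).Perm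
          (List.ofFn (fun ν : Fin n => beta c ν)))) ∧
    (∀ f : List (ℕ × ℕ), IsESeq f → f.length = n →
      ∃ c : ℕ → ℤ, APlus n c ∧
        ∀ v : Fin 2 → ℤ,
          (∃ p ∈ f, (![(p.1 : ℤ), (p.2 : ℤ)] : Fin 2 → ℤ) = v) ↔
            ∃ ν < n, beta c ν = v) := by
  refine ⟨fun c hc => ?_, fun f hf hfn => ?_⟩
  · have hpath := hc.isFareyPath
    have hpair := pairwise_slopeLT hpath.isChain
    refine ⟨fun ν hν => ?_, fun μ ν hμν hν heq => ?_,
      (List.range n).map (betaPair c), hpath.isESeq (by simpa using hn),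
      hpair.imp fun h => le_of_lt h, ?_⟩
    · rw [← hc.betaPair_eq hν]
      simp
    · have hlt := List.pairwise_iff_getElem.1 hpair μ ν (by simp; omega) (by simpa using hν) hμν
      simp only [List.getElem_map, List.getElem_range] at hlt
      rw [beta_eq, beta_eq] at heq
      have h₀ := congrFun heq 0
      have h₁ := congrFun heq 1
      simp only [Matrix.cons_val_zero, Matrix.cons_val_one] at h₀ h₁
      simp [SlopeLT, betaPair, h₀, h₁] at hlt
    · refine List.Perm.of_eq (List.ext_getElem (by simp) fun i hi _ => ?_)
      simp only [List.length_map, List.length_range] at hi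
      simp only [List.getElem_map, List.getElem_range, List.getElem_ofFn]
      exact hc.betaPair_eq hi
  · subst hfn
    obtain ⟨c, hc, hb⟩ := hf.isFareyPath.exists_aPlus hn
    refine ⟨c, hc, fun v => ⟨?_, ?_⟩⟩
    · rintro ⟨p, hp, rfl⟩
      obtain ⟨k, hk, rfl⟩ := List.getElem_of_mem hp
      exact ⟨k, hk, hb k hk⟩
    · rintro ⟨k, hk, rfl⟩
      exact ⟨f[k], List.getElem_mem hk, (hb k hk).symm⟩
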